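/- If F ⊆ ℕ → ℕ is unbounded with respect to ≤*, then the van Douwen space X_F is not metrizable. -/

import Mathlib

/-- The underlying type of the van Douwen space `X_F`:
the disjoint union `F ⊔ ℕ ⊔ (F × ℕ × ℕ)`. -/
def VDSpace (F : Set (ℕ → ℕ)) : Type := (↥F ⊕ ℕ) ⊕ (↥F × ℕ × ℕ)

namespace VDSpace

variable {F : Set (ℕ → ℕ)}

/-- The (isolated) points of `X_F` coming from `F × ℕ × ℕ`. -/
def pt (p : ↥F × ℕ × ℕ) : VDSpace F := Sum.inr p

/-- The points of `X_F` coming from functions in `F`. -/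
def fn (f : ↥F) : VDSpace F := Sum.inl (Sum.inl f)

/-- The points of `X_F` coming from natural numbers. -/
def nat (k : ℕ) : VDSpace F := Sum.inl (Sum.inr k)

/-- The basic neighborhood `O_{f,s} = {f} ∪ {(f, m, n) : f m = n, (m, n) ∉ s}` of `fn f`. -/
def basicO (f : ↥F) (s : Finset (ℕ × ℕ)) : Set (VDSpace F) :=
  {fn f} ∪ {x | ∃ m n : ℕ, (f : ℕ → ℕ) m = n ∧ (m, n) ∉ s ∧ x = pt (f, m, n)}

/-- The basic neighborhood `U_{k,n} = {k} ∪ {(g, k, l) : g ∈ F, l ≥ n}` of `nat k`. -/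
def basicU (k n : ℕ) : Set (VDSpace F) :=
  {nat k} ∪ {x | ∃ (g : ↥F) (l : ℕ), n ≤ l ∧ x = pt (g, k, l)}

/-- The topology of the van Douwen space: every point of `F × ℕ × ℕ` is isolated,
the sets `O_{f,s}` form a neighborhood basis of `f ∈ F`, and the sets `U_{k,n}` form a
neighborhood basis of `k ∈ ℕ`. -/
instance instTopVD (F : Set (ℕ → ℕ)) : TopologicalSpace (VDSpace F) :=
  TopologicalSpace.generateFrom
    ({V | ∃ p : ↥F × ℕ × ℕ, V = {pt p}} ∪
     {V | ∃ (f : ↥F) (s : Finset (ℕ × ℕ)), V = basicO f s} ∪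
     {V | ∃ k n : ℕ, V = (basicU k n : Set (VDSpace F))})

end VDSpace

/-- `f ≤* g`: eventual domination, i.e. `f n ≤ g n` for all but finitely many `n`. -/
def EvLE (f g : ℕ → ℕ) : Prop := ∀ᶠ n in Filter.atTop, f n ≤ g n

namespace VDSpace

variable {F : Set (ℕ → ℕ)}

theorem isOpen_singleton_pt (p : ↥F × ℕ × ℕ) : IsOpen ({pt p} : Set (VDSpace F)) :=
  TopologicalSpace.isOpen_generateFrom_of_mem (Or.inl (Or.inl ⟨p, rfl⟩))

theorem isOpen_basicO (f : ↥F) (s : Finset (ℕ × ℕ)) : IsOpen (basicO f s) :=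
  TopologicalSpace.isOpen_generateFrom_of_mem (Or.inl (Or.inr ⟨f, s, rfl⟩))

theorem isOpen_basicU (k n : ℕ) : IsOpen (basicU k n : Set (VDSpace F)) :=
  TopologicalSpace.isOpen_generateFrom_of_mem (Or.inr ⟨k, n, rfl⟩)

theorem basicO_anti (f : ↥F) {s t : Finset (ℕ × ℕ)} (h : s ⊆ t) : basicO f t ⊆ basicO f s := by
  rintro x (hx | ⟨m, n, hmn, hn, rfl⟩)
  · exact Or.inl hx
  · exact Or.inr ⟨m, n, hmn, fun hs => hn (h hs), rfl⟩

theorem basicU_anti (k : ℕ) {m n : ℕ} (h : m ≤ n) :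
    (basicU k n : Set (VDSpace F)) ⊆ basicU k m := by
  rintro x (hx | ⟨g, l, hl, rfl⟩)
  · exact Or.inl hx
  · exact Or.inr ⟨g, l, h.trans hl, rfl⟩

theorem fn_injective : Function.Injective (fn : ↥F → VDSpace F) :=
  Sum.inl_injective.comp Sum.inl_injective

theorem nat_injective : Function.Injective (nat : ℕ → VDSpace F) :=
  Sum.inl_injective.comp Sum.inr_injective

theorem fn_ne_pt (f : ↥F) (p : ↥F × ℕ × ℕ) : fn f ≠ pt p := Sum.inl_ne_inr

theorem nat_ne_pt (k : ℕ) (p : ↥F × ℕ × ℕ) : nat k ≠ pt p := Sum.inl_ne_inr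

theorem fn_ne_nat (f : ↥F) (k : ℕ) : fn f ≠ nat k := fun h =>
  Sum.inl_ne_inr (Sum.inl_injective h)

theorem exists_basicO_subset {V : Set (VDSpace F)} (hV : IsOpen V) {f : ↥F} (hf : fn f ∈ V) :
    ∃ s, basicO f s ⊆ V := by
  induction hV with
  | basic V hV =>
    rcases hV with (⟨p, rfl⟩ | ⟨g, s, rfl⟩) | ⟨k, n, rfl⟩
    · exact (fn_ne_pt f p hf).elim
    · rcases hf with hf | ⟨m, n, -, -, h⟩
      · exact ⟨s, (fn_injective hf ▸ subset_rfl)⟩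
      · exact (fn_ne_pt _ _ h).elim
    · rcases hf with hf | ⟨g, l, -, h⟩
      · exact (fn_ne_nat _ _ hf).elim
      · exact (fn_ne_pt _ _ h).elim
  | univ => exact ⟨∅, Set.subset_univ _⟩
  | inter V W _ _ hV hW =>
    obtain ⟨s, hs⟩ := hV hf.1
    obtain ⟨t, ht⟩ := hW hf.2
    exact ⟨s ∪ t, Set.subset_inter ((basicO_anti f Finset.subset_union_left).trans hs)
      ((basicO_anti f Finset.subset_union_right).trans ht)⟩
  | sUnion S _ hS =>
    obtain ⟨V, hVS, hfV⟩ := hf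
    obtain ⟨s, hs⟩ := hS V hVS hfV
    exact ⟨s, hs.trans (Set.subset_sUnion_of_mem hVS)⟩

theorem exists_basicU_subset {V : Set (VDSpace F)} (hV : IsOpen V) {k : ℕ} (hk : nat k ∈ V) :
    ∃ n, basicU k n ⊆ V := by
  induction hV with
  | basic V hV =>
    rcases hV with (⟨p, rfl⟩ | ⟨g, s, rfl⟩) | ⟨j, n, rfl⟩
    · exact (nat_ne_pt k p hk).elim
    · rcases hk with hk | ⟨m, n, -, -, h⟩
      · exact (fn_ne_nat _ _ (Eq.symm hk)).elim
      · exact (nat_ne_pt _ _ h).elim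
    · rcases hk with hk | ⟨g, l, -, h⟩
      · exact ⟨n, (nat_injective hk ▸ subset_rfl)⟩
      · exact (nat_ne_pt _ _ h).elim
  | univ => exact ⟨0, Set.subset_univ _⟩
  | inter V W _ _ hV hW =>
    obtain ⟨m, hm⟩ := hV hk.1
    obtain ⟨n, hn⟩ := hW hk.2
    exact ⟨max m n, Set.subset_inter ((basicU_anti k (le_max_left m n)).trans hm)
      ((basicU_anti k (le_max_right m n)).trans hn)⟩
  | sUnion S _ hS =>
    obtain ⟨V, hVS, hkV⟩ := hk
    obtain ⟨n, hn⟩ := hS V hVS hkV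
    exact ⟨n, hn.trans (Set.subset_sUnion_of_mem hVS)⟩

theorem isClosed_range_fn : IsClosed (Set.range (fn : ↥F → VDSpace F)) := by
  rw [← isOpen_compl_iff, isOpen_iff_forall_mem_open]
  rintro ((f | k) | p) hx
  · exact (hx ⟨f, rfl⟩).elim
  · refine ⟨basicU k 0, ?_, isOpen_basicU k 0, Or.inl rfl⟩
    rintro _ (h | ⟨g, l, -, h⟩) ⟨f, rfl⟩
    · exact fn_ne_nat _ _ h
    · exact fn_ne_pt _ _ h
  · refine ⟨{pt p}, ?_, isOpen_singleton_pt p, rfl⟩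
    rintro _ h ⟨f, rfl⟩
    exact fn_ne_pt _ _ h

theorem isClosed_range_nat : IsClosed (Set.range (nat : ℕ → VDSpace F)) := by
  rw [← isOpen_compl_iff, isOpen_iff_forall_mem_open]
  rintro ((f | k) | p) hx
  · refine ⟨basicO f ∅, ?_, isOpen_basicO f ∅, Or.inl rfl⟩
    rintro _ (h | ⟨m, n, -, -, h⟩) ⟨k, rfl⟩
    · exact fn_ne_nat _ _ (Eq.symm h)
    · exact nat_ne_pt _ _ h
  · exact (hx ⟨k, rfl⟩).elim
  · refine ⟨{pt p}, ?_, isOpen_singleton_pt p, rfl⟩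
    rintro _ h ⟨k, rfl⟩
    exact nat_ne_pt _ _ h

/-- If `X_F` is normal, separating the closed sets `F` and `ℕ` by open sets yields a bound
for `F`. -/
theorem exists_bound_of_normalSpace [NormalSpace (VDSpace F)] :
    ∃ g : ℕ → ℕ, ∀ f ∈ F, ∀ᶠ n in Filter.atTop, f n ≤ g n := by
  have hdisj : Disjoint (Set.range (fn : ↥F → VDSpace F)) (Set.range nat) := by
    rw [Set.disjoint_left]
    rintro _ ⟨f, rfl⟩ ⟨k, hk⟩
    exact fn_ne_nat _ _ hk.symm
  obtain ⟨U, V, hU, hV, hFU, hNV, hUV⟩ :=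
    normal_separation isClosed_range_fn isClosed_range_nat hdisj
  choose g hg using fun k => exists_basicU_subset hV (hNV ⟨k, rfl⟩)
  refine ⟨g, fun f hf => ?_⟩
  obtain ⟨s, hs⟩ := exists_basicO_subset hU (hFU ⟨⟨f, hf⟩, rfl⟩)
  have hfin : ∀ᶠ m in Filter.atTop, m ∉ s.image Prod.fst := by
    rw [← Nat.cofinite_eq_atTop]
    exact (s.image Prod.fst).eventually_cofinite_notMem
  filter_upwards [hfin] with m hm
  by_contra! hlt
  have hU' : pt (⟨f, hf⟩, m, f m) ∈ U :=
    hs (Or.inr ⟨m, f m, rfl, fun h => hm (Finset.mem_image_of_mem Prod.fst h), rfl⟩)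
  exact Set.disjoint_left.1 hUV hU' (hg m (Or.inr ⟨⟨f, hf⟩, f m, hlt.le, rfl⟩))

end VDSpace

/-- If `F ⊆ ℕ → ℕ` is unbounded with respect to `≤*`, then the van Douwen space `X_F` is
not metrizable. -/
theorem vanDouwen_not_metrizable (F : Set (ℕ → ℕ))
    (hF : ¬ ∃ g : ℕ → ℕ, ∀ f ∈ F, EvLE f g) :
    ¬ TopologicalSpace.MetrizableSpace (VDSpace F) := by
  intro _
  exact hF VDSpace.exists_bound_of_normalSpace
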